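/- arXiv:2208.13454 — 9 statements merged into one kernel-verified Lean document; each statement's English description precedes it below -/
import Mathlib

section
/- For any property Σ_P, an input sectional data (X,U) is sufficiently rich for identifying Σ_P if and only if the column span of [X;U] contains the minimum subspace L_P. -/
open Matrix

abbrev Sys (n m : ℕ) : Type := Matrix (Fin n) (Fin n) ℝ × Matrix (Fin n) (Fin m) ℝ

/-- The consistency set Σ_D(X,U|A,B): all systems producing the same feedback data. -/
def consistSet {n m k : ℕ} (X : Matrix (Fin n) (Fin k) ℝ) (U : Matrix (Fin m) (Fin k) ℝ)
    (A : Matrix (Fin n) (Fin n) ℝ) (B : Matrix (Fin n) (Fin m) ℝ) : Set (Sys n m) :=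
  {s | s.1 * X + s.2 * U = A * X + B * U}

/-- (X,U) is sufficiently rich for identifying the property P. -/
def suffRich {n m k : ℕ} (X : Matrix (Fin n) (Fin k) ℝ) (U : Matrix (Fin m) (Fin k) ℝ)
    (P : Set (Sys n m)) : Prop :=
  ∀ A B, consistSet X U A B ⊆ P ∨ consistSet X U A B ⊆ Pᶜ

/-- Column span of the stacked matrix [X;U]. -/
def colSpan {n m k : ℕ} (X : Matrix (Fin n) (Fin k) ℝ) (U : Matrix (Fin m) (Fin k) ℝ) :
    Submodule ℝ (Fin n ⊕ Fin m → ℝ) :=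
  Submodule.span ℝ (Set.range (Matrix.fromRows X U)ᵀ)

/-- The minimum subspace L_P: intersection of column spans of all sufficiently rich data. -/
def minSubspace {n m : ℕ} (P : Set (Sys n m)) : Submodule ℝ (Fin n ⊕ Fin m → ℝ) :=
  ⨅ (k : ℕ) (X : Matrix (Fin n) (Fin k) ℝ) (U : Matrix (Fin m) (Fin k) ℝ)
    (_ : suffRich X U P), colSpan X U

/-- The linear map associated with a system. -/
noncomputable def sysMap {n m : ℕ} (s : Sys n m) : (Fin n ⊕ Fin m → ℝ) →ₗ[ℝ] (Fin n → ℝ) :=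
  Matrix.toLin' (Matrix.fromCols s.1 s.2)

/-- The property is determined by the restriction of the system to L. -/
def goodSub {n m : ℕ} (P : Set (Sys n m)) (L : Submodule ℝ (Fin n ⊕ Fin m → ℝ)) : Prop :=
  ∀ s t : Sys n m, (∀ v ∈ L, sysMap s v = sysMap t v) → s ∈ P → t ∈ P

lemma sysMap_surj {n m : ℕ} (f : (Fin n ⊕ Fin m → ℝ) →ₗ[ℝ] (Fin n → ℝ)) :
    ∃ s : Sys n m, sysMap s = f := by
  refine ⟨((LinearMap.toMatrix' f).toCols₁, (LinearMap.toMatrix' f).toCols₂), ?_⟩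
  simp [sysMap]

lemma mem_consist_iff {n m k : ℕ} (X : Matrix (Fin n) (Fin k) ℝ) (U : Matrix (Fin m) (Fin k) ℝ)
    (s t : Sys n m) :
    s ∈ consistSet X U t.1 t.2 ↔ ∀ v ∈ colSpan X U, sysMap s v = sysMap t v := by
  have h1 : s ∈ consistSet X U t.1 t.2 ↔
      ∀ j, sysMap s ((Matrix.fromRows X U)ᵀ j) = sysMap t ((Matrix.fromRows X U)ᵀ j) := by
    simp only [consistSet, Set.mem_setOf_eq, ← Matrix.fromCols_mul_fromRows]
    constructor
    · intro h j
      ext i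
      exact congrFun (congrFun h i) j
    · intro h
      ext i j
      exact congrFun (h j) i
  rw [h1]
  constructor
  · intro h v hv
    have : Set.EqOn (sysMap s) (sysMap t) (Set.range (Matrix.fromRows X U)ᵀ) := by
      rintro _ ⟨j, rfl⟩
      exact h j
    exact LinearMap.eqOn_span this hv
  · intro h j
    exact h _ (Submodule.subset_span ⟨j, rfl⟩)

lemma suffRich_iff_good {n m k : ℕ} (X : Matrix (Fin n) (Fin k) ℝ)
    (U : Matrix (Fin m) (Fin k) ℝ) (P : Set (Sys n m)) :
    suffRich X U P ↔ goodSub P (colSpan X U) := by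
  constructor
  · intro h s t hst hs
    have ht : t ∈ consistSet X U s.1 s.2 :=
      (mem_consist_iff X U t s).2 fun v hv => (hst v hv).symm
    have hss : s ∈ consistSet X U s.1 s.2 := rfl
    rcases h s.1 s.2 with h | h
    · exact h ht
    · exact absurd hs (h hss)
  · intro h A B
    by_cases hAB : ((A, B) : Sys n m) ∈ P
    · left
      intro t ht
      exact h (A, B) t (fun v hv => ((mem_consist_iff X U t (A, B)).1 ht v hv).symm) hAB
    · right
      intro t ht htP
      exact hAB (h t (A, B) ((mem_consist_iff X U t (A, B)).1 ht) htP)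

lemma goodSub_mono {n m : ℕ} {P : Set (Sys n m)} {L M : Submodule ℝ (Fin n ⊕ Fin m → ℝ)}
    (hLM : L ≤ M) (h : goodSub P L) : goodSub P M :=
  fun s t hst => h s t fun v hv => hst v (hLM hv)

lemma goodSub_inf {n m : ℕ} {P : Set (Sys n m)} {L M : Submodule ℝ (Fin n ⊕ Fin m → ℝ)}
    (hL : goodSub P L) (hM : goodSub P M) : goodSub P (L ⊓ M) := by
  intro s t hst hs
  -- a map agreeing with `s` on `L` and with `t` on `M`
  let f : (Fin n ⊕ Fin m → ℝ) →ₗ.[ℝ] (Fin n → ℝ) := ⟨L, (sysMap s).domRestrict L⟩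
  let g : (Fin n ⊕ Fin m → ℝ) →ₗ.[ℝ] (Fin n → ℝ) := ⟨M, (sysMap t).domRestrict M⟩
  have hfg : ∀ (x : f.domain) (y : g.domain), (x : Fin n ⊕ Fin m → ℝ) = y → f x = g y := by
    rintro ⟨x, hx⟩ ⟨y, hy⟩ hxy
    change x = y at hxy
    subst hxy
    exact hst x ⟨hx, hy⟩
  obtain ⟨e, he⟩ := LinearMap.exists_extend (f.sup g hfg).toFun
  obtain ⟨r, rfl⟩ := sysMap_surj e
  have he' : ∀ z : (f.sup g hfg).domain, sysMap r z = f.sup g hfg z :=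
    fun z => LinearMap.congr_fun he z
  refine hM r t ?_ (hL s r ?_ hs)
  · intro v hv
    have h2 := (LinearPMap.right_le_sup f g hfg)
    exact (he' ⟨v, h2.1 hv⟩).trans (h2.2 (x := ⟨v, hv⟩) (y := ⟨v, h2.1 hv⟩) rfl).symm
  · intro v hv
    have h2 := (LinearPMap.left_le_sup f g hfg)
    exact ((he' ⟨v, h2.1 hv⟩).trans (h2.2 (x := ⟨v, hv⟩) (y := ⟨v, h2.1 hv⟩) rfl).symm).symm

lemma goodSub_top {n m : ℕ} (P : Set (Sys n m)) : goodSub P ⊤ := by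
  intro s t hst hs
  have h : sysMap s = sysMap t := LinearMap.ext fun v => hst v trivial
  have h2 := Matrix.toLin'.injective h
  obtain ⟨h3, h4⟩ := Matrix.fromCols_inj h2
  have : s = t := Prod.ext h3 h4
  exact this ▸ hs

lemma exists_least_good {n m : ℕ} (P : Set (Sys n m)) :
    ∃ L, goodSub P L ∧ ∀ M, goodSub P M → L ≤ M := by
  obtain ⟨L, hL, hmin⟩ := (wellFounded_lt
    (α := Submodule ℝ (Fin n ⊕ Fin m → ℝ))).has_min {L | goodSub P L} ⟨⊤, goodSub_top P⟩
  refine ⟨L, hL, fun M hM => ?_⟩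
  by_contra hLM
  exact hmin (L ⊓ M) (goodSub_inf hL hM) (inf_lt_left.2 hLM)

/-- (X,U) is sufficiently rich for identifying Σ_P iff the column span of
[X;U] contains the minimum subspace L_P. -/
theorem statement1 {n m k : ℕ} (hn : 1 ≤ n) (hm : 1 ≤ m)
    (P : Set (Sys n m))
    (X : Matrix (Fin n) (Fin k) ℝ) (U : Matrix (Fin m) (Fin k) ℝ) :
    suffRich X U P ↔ minSubspace P ≤ colSpan X U := by
  rw [suffRich_iff_good]
  constructor
  · intro h
    exact iInf_le_of_le k (iInf_le_of_le X (iInf_le_of_le U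
      (iInf_le_of_le ((suffRich_iff_good X U P).2 h) le_rfl)))
  · intro h
    obtain ⟨L, hL, hmin⟩ := exists_least_good P
    refine goodSub_mono (le_trans ?_ h) hL
    refine le_iInf fun k' => le_iInf fun X' => le_iInf fun U' => le_iInf fun h' => ?_
    exact hmin _ ((suffRich_iff_good X' U' P).1 h')
end

section
/- For any property Σ_P, the dimension of the minimum subspace L_P is the least element of the set of all natural numbers k such that there exists an input sectional data (X,U) with k columns that is sufficiently rich for identifying Σ_P. -/
open Matrix

def RichSub {n m : ℕ} (P : Set (Sys n m)) (S : Submodule ℝ (Fin n ⊕ Fin m → ℝ)) : Prop :=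
  ∀ s t : Sys n m, (∀ v ∈ S, fromCols s.1 s.2 *ᵥ v = fromCols t.1 t.2 *ᵥ v) → (s ∈ P → t ∈ P)

theorem factor_exists {V W Z : Type*} [AddCommGroup V] [Module ℝ V] [AddCommGroup W] [Module ℝ W]
    [AddCommGroup Z] [Module ℝ Z] (q : V →ₗ[ℝ] Z) (d : V →ₗ[ℝ] W)
    (h : LinearMap.ker q ≤ LinearMap.ker d) : ∃ e : Z →ₗ[ℝ] W, e ∘ₗ q = d := by
  obtain ⟨e, he⟩ := LinearMap.exists_extend
    (((LinearMap.ker q).liftQ d h) ∘ₗ q.quotKerEquivRange.symm.toLinearMap)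
  refine ⟨e, ?_⟩
  ext v
  have := LinearMap.congr_fun he ⟨q v, LinearMap.mem_range_self q v⟩
  have h2 : q.quotKerEquivRange.symm ⟨q v, LinearMap.mem_range_self q v⟩
      = (LinearMap.ker q).mkQ v := by
    rw [LinearEquiv.symm_apply_eq]; rfl
  simpa [h2] using this

theorem decomp_exists {V W : Type*} [AddCommGroup V] [Module ℝ V] [AddCommGroup W] [Module ℝ W]
    (S T : Submodule ℝ V) (d : V →ₗ[ℝ] W) (h : ∀ v ∈ S ⊓ T, d v = 0) :
    ∃ f g : V →ₗ[ℝ] W, (∀ v ∈ S, f v = 0) ∧ (∀ v ∈ T, g v = 0) ∧ d = f + g := by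
  obtain ⟨e, he⟩ := factor_exists (S.mkQ.prod T.mkQ) d (by
    intro v hv
    simp only [LinearMap.ker_prod, Submodule.ker_mkQ] at hv
    exact h v hv)
  refine ⟨e ∘ₗ LinearMap.inl ℝ _ _ ∘ₗ S.mkQ, e ∘ₗ LinearMap.inr ℝ _ _ ∘ₗ T.mkQ, ?_, ?_, ?_⟩
  · intro v hv
    have : S.mkQ v = 0 := by simpa using hv
    simp only [LinearMap.comp_apply, this, map_zero]
  · intro v hv
    have : T.mkQ v = 0 := by simpa using hv
    simp only [LinearMap.comp_apply, this, map_zero]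
  · rw [← he]
    ext v
    simp only [LinearMap.comp_apply, LinearMap.add_apply, ← map_add]
    simp

theorem RichSub.inf {n m : ℕ} {P : Set (Sys n m)} {S T : Submodule ℝ (Fin n ⊕ Fin m → ℝ)}
    (hS : RichSub P S) (hT : RichSub P T) : RichSub P (S ⊓ T) := by
  intro s t h hs
  obtain ⟨f, g, hf, hg, hd⟩ := decomp_exists S T
    ((fromCols s.1 s.2).mulVecLin - (fromCols t.1 t.2).mulVecLin) (by
      intro v hv
      simp [h v hv])
  set G := LinearMap.toMatrix' g with hG
  set r : Sys n m := (t.1 + G.toCols₁, t.2 + G.toCols₂) with hr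
  have hrv : ∀ v, fromCols r.1 r.2 *ᵥ v = fromCols t.1 t.2 *ᵥ v + g v := by
    intro v
    have h1 : fromCols r.1 r.2 = fromCols t.1 t.2 + G := by
      ext i (j | j) <;> simp [hr, toCols₁, toCols₂]
    rw [h1, add_mulVec, hG, LinearMap.toMatrix'_mulVec]
  have hdv : ∀ v, fromCols s.1 s.2 *ᵥ v - fromCols t.1 t.2 *ᵥ v = f v + g v := by
    intro v
    simpa using LinearMap.congr_fun hd v
  refine hT r t (fun v hv => by rw [hrv, hg v hv, add_zero]) (hS s r (fun v hv => ?_) hs)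
  have := hdv v
  rw [hf v hv, zero_add, sub_eq_iff_eq_add] at this
  rw [hrv, this, add_comm]

theorem consist_iff {n m k : ℕ} (X : Matrix (Fin n) (Fin k) ℝ) (U : Matrix (Fin m) (Fin k) ℝ)
    (s t : Sys n m) : s ∈ consistSet X U t.1 t.2 ↔
      ∀ v ∈ colSpan X U, fromCols s.1 s.2 *ᵥ v = fromCols t.1 t.2 *ᵥ v := by
  have key : s ∈ consistSet X U t.1 t.2 ↔
      ∀ j, fromCols s.1 s.2 *ᵥ ((fromRows X U)ᵀ j) = fromCols t.1 t.2 *ᵥ ((fromRows X U)ᵀ j) := by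
    simp only [consistSet, Set.mem_ofPred_eq, ← fromCols_mul_fromRows]
    constructor
    · intro h j
      ext i
      exact congrFun (congrFun h i) j
    · intro h
      ext i j
      exact congrFun (h j) i
  rw [key]
  constructor
  · intro h v hv
    have : colSpan X U ≤ LinearMap.eqLocus (fromCols s.1 s.2).mulVecLin
        (fromCols t.1 t.2).mulVecLin := by
      rw [colSpan, Submodule.span_le]
      rintro _ ⟨j, rfl⟩
      exact h j
    exact this hv
  · intro h j
    exact h _ (Submodule.subset_span ⟨j, rfl⟩)

theorem suffRich_iff {n m k : ℕ} (X : Matrix (Fin n) (Fin k) ℝ) (U : Matrix (Fin m) (Fin k) ℝ)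
    (P : Set (Sys n m)) : suffRich X U P ↔ RichSub P (colSpan X U) := by
  constructor
  · intro h s t hst hs
    rcases h t.1 t.2 with h | h
    · exact h ((consist_iff X U t t).2 fun _ _ => rfl)
    · exact absurd hs (h ((consist_iff X U s t).2 hst))
  · intro h A B
    by_cases hp : ((A, B) : Sys n m) ∈ P
    · left
      intro s hs
      exact h (A, B) s (fun v hv => ((consist_iff X U s (A, B)).1 hs v hv).symm) hp
    · right
      intro s hs hsP
      exact hp (h s (A, B) ((consist_iff X U s (A, B)).1 hs) hsP)

theorem exists_data {n m : ℕ} (S : Submodule ℝ (Fin n ⊕ Fin m → ℝ)) :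
    ∃ (X : Matrix (Fin n) (Fin (Module.finrank ℝ S)) ℝ)
      (U : Matrix (Fin m) (Fin (Module.finrank ℝ S)) ℝ), colSpan X U = S := by
  let b := Module.finBasis ℝ S
  refine ⟨fun i j => (b j : Fin n ⊕ Fin m → ℝ) (Sum.inl i), fun i j => (b j : Fin n ⊕ Fin m → ℝ) (Sum.inr i), ?_⟩
  have h1 : (fromRows (fun i j => (b j : Fin n ⊕ Fin m → ℝ) (Sum.inl i))
      (fun i j => (b j : Fin n ⊕ Fin m → ℝ) (Sum.inr i)))ᵀ = (S.subtype ∘ b : _ → (Fin n ⊕ Fin m → ℝ)) := by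
    ext j (i | i) <;> rfl
  have h2 := congrArg (fun f : Fin (Module.finrank ℝ S) → (Fin n ⊕ Fin m → ℝ) =>
    Submodule.span ℝ (Set.range f)) h1
  refine h2.trans ?_
  change Submodule.span ℝ (Set.range (S.subtype ∘ b)) = S
  rw [Set.range_comp, Submodule.span_image, b.span_eq, Submodule.map_top,
    Submodule.range_subtype]

theorem minSubspace_le {n m k : ℕ} {P : Set (Sys n m)} {X : Matrix (Fin n) (Fin k) ℝ}
    {U : Matrix (Fin m) (Fin k) ℝ} (h : suffRich X U P) : minSubspace P ≤ colSpan X U :=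
  iInf_le_of_le k (iInf_le_of_le X (iInf_le_of_le U (iInf_le_of_le h le_rfl)))

theorem RichSub.top {n m : ℕ} (P : Set (Sys n m)) : RichSub P ⊤ := by
  intro s t h hs
  have h1 : fromCols s.1 s.2 = fromCols t.1 t.2 :=
    Matrix.mulVec_injective (funext fun v => h v trivial)
  have h2 := Matrix.fromCols_inj h1
  have : s = t := Prod.ext h2.1 h2.2
  exact this ▸ hs

theorem minSubspace_rich {n m : ℕ} (P : Set (Sys n m)) : RichSub P (minSubspace P) := by
  obtain ⟨S, hS, hmin⟩ := WellFounded.has_min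
    (wellFounded_lt (α := Submodule ℝ (Fin n ⊕ Fin m → ℝ))) {S | RichSub P S} ⟨⊤, RichSub.top P⟩
  have hle : ∀ T, RichSub P T → S ≤ T := by
    intro T hT
    by_contra hn
    exact hmin (S ⊓ T) (RichSub.inf hS hT) (inf_lt_left.2 hn)
  have : minSubspace P = S := by
    apply le_antisymm
    · obtain ⟨X, U, h⟩ := exists_data S
      have := minSubspace_le (P := P) ((suffRich_iff X U P).2 (h.symm ▸ hS))
      rwa [h] at this
    · simp only [minSubspace, le_iInf_iff]
      intro k X U h
      exact hle _ ((suffRich_iff X U P).1 h)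
  rw [this]
  exact hS

/-- the dimension of L_P is the least number of columns of a
sufficiently rich input sectional data. -/
theorem statement2 {n m : ℕ} (hn : 1 ≤ n) (hm : 1 ≤ m) (P : Set (Sys n m)) :
    IsLeast {k : ℕ | ∃ (X : Matrix (Fin n) (Fin k) ℝ) (U : Matrix (Fin m) (Fin k) ℝ),
      suffRich X U P} (Module.finrank ℝ (minSubspace P)) := by
  constructor
  · obtain ⟨X, U, h⟩ := exists_data (minSubspace P)
    exact ⟨X, U, (suffRich_iff X U P).2 (h.symm ▸ minSubspace_rich P)⟩
  · rintro k ⟨X, U, h⟩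
    refine (Submodule.finrank_mono (minSubspace_le h)).trans ?_
    have := finrank_range_le_card (R := ℝ) (fromRows X U)ᵀ
    rw [Fintype.card_fin] at this
    exact this
end

section
/- Let L be a linear subspace of ℝ^{n+m} and suppose some input sectional data (X̂,Û) whose columns form a basis of L (i.e., the columns of [X̂;Û] are linearly independent and span L) is sufficiently rich for identifying a property Σ_P. Then any input sectional data (X,U) whose column span of [X;U] contains L is sufficiently rich for identifying Σ_P. -/
open Matrix

/-- if some basis of L is sufficiently rich for Σ_P, then any data whose
column span contains L is sufficiently rich for Σ_P. -/
theorem statement5 {n m : ℕ} (hn : 1 ≤ n) (hm : 1 ≤ m) (P : Set (Sys n m))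
    (L : Submodule ℝ (Fin n ⊕ Fin m → ℝ))
    {k₁ : ℕ} (X₁ : Matrix (Fin n) (Fin k₁) ℝ) (U₁ : Matrix (Fin m) (Fin k₁) ℝ)
    (h₁ind : LinearIndependent ℝ (Matrix.fromRows X₁ U₁)ᵀ)
    (h₁span : colSpan X₁ U₁ = L)
    (h₁rich : suffRich X₁ U₁ P)
    {k : ℕ} (X : Matrix (Fin n) (Fin k) ℝ) (U : Matrix (Fin m) (Fin k) ℝ)
    (hcontain : L ≤ colSpan X U) :
    suffRich X U P := by
  have key : ∀ A B, consistSet X U A B ⊆ consistSet X₁ U₁ A B := by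
    intro A B s hs
    have hs' : s.1 * X + s.2 * U = A * X + B * U := hs
    rw [← Matrix.fromCols_mul_fromRows, ← Matrix.fromCols_mul_fromRows] at hs'
    change s.1 * X₁ + s.2 * U₁ = A * X₁ + B * U₁
    rw [← Matrix.fromCols_mul_fromRows, ← Matrix.fromCols_mul_fromRows]
    have hE : Set.EqOn (Matrix.fromCols s.1 s.2).mulVecLin (Matrix.fromCols A B).mulVecLin
        (Set.range (Matrix.fromRows X U)ᵀ) := by
      rintro _ ⟨j, rfl⟩
      ext i
      exact congrFun (congrFun hs' i) j
    have hE2 := LinearMap.eqOn_span hE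
    ext i j
    have hj : (Matrix.fromRows X₁ U₁)ᵀ j ∈ colSpan X U := by
      apply hcontain
      rw [← h₁span]
      exact Submodule.subset_span ⟨j, rfl⟩
    exact congrFun (hE2 hj) i
  intro A B
  rcases h₁rich A B with h | h
  · exact Or.inl ((key A B).trans h)
  · exact Or.inr ((key A B).trans h)
end

section
/- Let L₁ and L₂ be linear subspaces of ℝ^{n+m}, each admitting an input sectional data whose columns form a basis of it and which is sufficiently rich for identifying a property Σ_P. Then any input sectional data (X,U) whose columns form a basis of the intersection L₁ ∩ L₂ is sufficiently rich for identifying Σ_P. -/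
open Matrix

theorem mem_consistSet_iff {n m k : ℕ} (X : Matrix (Fin n) (Fin k) ℝ)
    (U : Matrix (Fin m) (Fin k) ℝ) (A : Matrix (Fin n) (Fin n) ℝ) (B : Matrix (Fin n) (Fin m) ℝ)
    (s : Sys n m) : s ∈ consistSet X U A B ↔
      ∀ v ∈ colSpan X U, Matrix.fromCols s.1 s.2 *ᵥ v = Matrix.fromCols A B *ᵥ v := by
  have h0 : s ∈ consistSet X U A B ↔ Matrix.fromCols s.1 s.2 * Matrix.fromRows X U =
      Matrix.fromCols A B * Matrix.fromRows X U := by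
    rw [Matrix.fromCols_mul_fromRows, Matrix.fromCols_mul_fromRows]; rfl
  rw [h0]
  constructor
  · intro h v hv
    induction hv using Submodule.span_induction with
    | mem x hx =>
      obtain ⟨j, rfl⟩ := hx
      funext i
      exact congrFun (congrFun h i) j
    | zero => simp
    | add x y _ _ hx hy => rw [Matrix.mulVec_add, Matrix.mulVec_add, hx, hy]
    | smul a x _ hx => rw [Matrix.mulVec_smul, Matrix.mulVec_smul, hx]
  · intro h
    ext i j
    exact congrFun (h _ (Submodule.subset_span ⟨j, rfl⟩)) i

theorem suffRich_iff_s6 {n m k : ℕ} (X : Matrix (Fin n) (Fin k) ℝ)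
    (U : Matrix (Fin m) (Fin k) ℝ) (P : Set (Sys n m)) : suffRich X U P ↔
      ∀ s t : Sys n m, (∀ v ∈ colSpan X U,
        Matrix.fromCols s.1 s.2 *ᵥ v = Matrix.fromCols t.1 t.2 *ᵥ v) → (s ∈ P ↔ t ∈ P) := by
  constructor
  · intro h s t hst
    have hs := (mem_consistSet_iff X U t.1 t.2 s).2 hst
    have ht := (mem_consistSet_iff X U t.1 t.2 t).2 (fun _ _ => rfl)
    rcases h t.1 t.2 with h | h
    · exact ⟨fun _ => h ht, fun _ => h hs⟩
    · exact ⟨fun q => absurd q (h hs), fun q => absurd q (h ht)⟩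
  · intro h A B
    by_cases hP : ((A, B) : Sys n m) ∈ P
    · left
      intro s hs
      exact (h s (A, B) ((mem_consistSet_iff X U A B s).1 hs)).2 hP
    · right
      intro s hs q
      exact hP ((h s (A, B) ((mem_consistSet_iff X U A B s).1 hs)).1 q)

theorem exists_glue {V W : Type*} [AddCommGroup V] [Module ℝ V] [AddCommGroup W] [Module ℝ W]
    (L₁ L₂ : Submodule ℝ V) (f g : V →ₗ[ℝ] W) (h : ∀ v ∈ L₁ ⊓ L₂, f v = g v) :
    ∃ t : V →ₗ[ℝ] W, (∀ v ∈ L₁, t v = f v) ∧ ∀ v ∈ L₂, t v = g v := by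
  let p : V →ₗ.[ℝ] W := ⟨L₁, f.domRestrict L₁⟩
  let q : V →ₗ.[ℝ] W := ⟨L₂, g.domRestrict L₂⟩
  have hpq : ∀ (x : p.domain) (y : q.domain), (x : V) = y → p x = q y := by
    intro x y hxy
    change f x = g y
    rw [← hxy]
    exact h _ ⟨x.2, hxy ▸ y.2⟩
  obtain ⟨t, ht⟩ := LinearMap.exists_extend (p.sup q hpq).toFun
  refine ⟨t, fun v hv => ?_, fun v hv => ?_⟩
  · have h1 := (LinearPMap.left_le_sup p q hpq)
    have h2 := h1.2 (x := ⟨v, hv⟩) (y := ⟨v, h1.1 hv⟩) rfl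
    exact (LinearMap.congr_fun ht ⟨v, h1.1 hv⟩).trans h2.symm
  · have h1 := (LinearPMap.right_le_sup p q hpq)
    have h2 := h1.2 (x := ⟨v, hv⟩) (y := ⟨v, h1.1 hv⟩) rfl
    exact (LinearMap.congr_fun ht ⟨v, h1.1 hv⟩).trans h2.symm

/-- if L₁ and L₂ each admit a sufficiently rich basis for Σ_P, then any
basis of L₁ ∩ L₂ is sufficiently rich for Σ_P. -/
theorem statement6 {n m : ℕ} (hn : 1 ≤ n) (hm : 1 ≤ m) (P : Set (Sys n m))
    (L₁ L₂ : Submodule ℝ (Fin n ⊕ Fin m → ℝ))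
    (h₁ : ∃ (k₁ : ℕ) (X₁ : Matrix (Fin n) (Fin k₁) ℝ) (U₁ : Matrix (Fin m) (Fin k₁) ℝ),
      LinearIndependent ℝ (Matrix.fromRows X₁ U₁)ᵀ ∧ colSpan X₁ U₁ = L₁ ∧ suffRich X₁ U₁ P)
    (h₂ : ∃ (k₂ : ℕ) (X₂ : Matrix (Fin n) (Fin k₂) ℝ) (U₂ : Matrix (Fin m) (Fin k₂) ℝ),
      LinearIndependent ℝ (Matrix.fromRows X₂ U₂)ᵀ ∧ colSpan X₂ U₂ = L₂ ∧ suffRich X₂ U₂ P)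
    {k : ℕ} (X : Matrix (Fin n) (Fin k) ℝ) (U : Matrix (Fin m) (Fin k) ℝ)
    (hind : LinearIndependent ℝ (Matrix.fromRows X U)ᵀ)
    (hspan : colSpan X U = L₁ ⊓ L₂) :
    suffRich X U P := by
  obtain ⟨k₁, X₁, U₁, -, rfl, r₁⟩ := h₁
  obtain ⟨k₂, X₂, U₂, -, rfl, r₂⟩ := h₂
  rw [suffRich_iff_s6] at r₁ r₂ ⊢
  intro s t hst
  rw [hspan] at hst
  obtain ⟨g, hg₁, hg₂⟩ := exists_glue _ _ (Matrix.mulVecLin (Matrix.fromCols s.1 s.2))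
    (Matrix.mulVecLin (Matrix.fromCols t.1 t.2)) hst
  have key : ∀ v, Matrix.fromCols (LinearMap.toMatrix' g).toCols₁ (LinearMap.toMatrix' g).toCols₂
      *ᵥ v = g v := by
    intro v
    rw [Matrix.fromCols_toCols, LinearMap.toMatrix'_mulVec]
  let w : Sys n m := ((LinearMap.toMatrix' g).toCols₁, (LinearMap.toMatrix' g).toCols₂)
  exact (r₁ w s fun v hv => (key v).trans (hg₁ v hv)).symm.trans
    (r₂ w t fun v hv => (key v).trans (hg₂ v hv))
end

section
/- An input sectional data (X,U) satisfies Σ_D(X,U|A,B) = {(A,B)} for every linear system (A,B) (i.e., the system model is identifiable from the data) if and only if the column span of [X;U] is all of ℝ^{n+m}, i.e., rank([X;U]) = n+m. -/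
open Matrix

theorem colSpan_top_iff {n m k : ℕ}
    (X : Matrix (Fin n) (Fin k) ℝ) (U : Matrix (Fin m) (Fin k) ℝ) :
    colSpan X U = ⊤ ↔
      ∀ w : Fin n ⊕ Fin m → ℝ, w ᵥ* Matrix.fromRows X U = 0 → w = 0 := by
  constructor
  · intro h w hw
    have hle : colSpan X U ≤ LinearMap.ker (dotProductBilin ℝ ℝ w) := by
      refine Submodule.span_le.2 ?_
      rintro _ ⟨j, rfl⟩
      exact congrFun hw j
    rw [h] at hle
    have : w ⬝ᵥ w = 0 := hle (Submodule.mem_top (x := w))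
    exact dotProduct_self_eq_zero.1 this
  · intro h
    by_contra hne
    obtain ⟨f, hf, hle⟩ := Submodule.exists_le_ker_of_lt_top _ (lt_top_iff_ne_top.2 hne)
    have hfw : ∀ v, f v = (fun a => f (fun j => if a = j then 1 else 0)) ⬝ᵥ v := by
      intro v
      rw [LinearMap.pi_apply_eq_sum_univ f v]
      simp [dotProduct, mul_comm]
    have hw := h (fun a => f (fun j => if a = j then 1 else 0)) (by
      funext j
      have : f ((Matrix.fromRows X U)ᵀ j) = 0 := hle (Submodule.subset_span ⟨j, rfl⟩)
      rw [hfw] at this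
      exact this)
    apply hf
    refine LinearMap.ext fun v => ?_
    rw [hfw v, hw, zero_dotProduct]
    rfl

/-- the system model is identifiable from (X,U) (the consistency set of
every system is the singleton of that system) iff the column span of [X;U] is all of
ℝ^{n+m}. -/
theorem statement7 {n m k : ℕ} (hn : 1 ≤ n) (hm : 1 ≤ m)
    (X : Matrix (Fin n) (Fin k) ℝ) (U : Matrix (Fin m) (Fin k) ℝ) :
    (∀ (A : Matrix (Fin n) (Fin n) ℝ) (B : Matrix (Fin n) (Fin m) ℝ),
      consistSet X U A B = {(A, B)}) ↔ colSpan X U = ⊤ := by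
  rw [colSpan_top_iff]
  constructor
  · intro h w hw
    have hs : ((Matrix.of fun _ j => w (Sum.inl j), Matrix.of fun _ j => w (Sum.inr j)) :
        Sys n m) ∈ consistSet X U 0 0 := by
      change _ = _
      ext i j
      have := congrFun hw j
      simpa [Matrix.mul_apply, Matrix.vecMul, dotProduct] using this
    rw [h 0 0] at hs
    have hs' := Prod.ext_iff.1 (Set.mem_singleton_iff.1 hs)
    funext a
    rcases a with a | a
    · exact congrFun (congrFun hs'.1 ⟨0, hn⟩) a
    · exact congrFun (congrFun hs'.2 ⟨0, hn⟩) a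
  · intro h A B
    ext ⟨A', B'⟩
    rw [Set.mem_singleton_iff]
    constructor
    · intro hs
      have hs : A' * X + B' * U = A * X + B * U := hs
      have key : ∀ i, Sum.elim ((A' - A) i) ((B' - B) i) = 0 := by
        intro i
        apply h
        funext j
        have := congrFun (congrFun hs i) j
        simp only [Matrix.add_apply, Matrix.mul_apply] at this
        simp [Matrix.vecMul, dotProduct, sub_mul, Finset.sum_sub_distrib]
        linarith
      refine Prod.ext ?_ ?_
      · ext i j
        exact sub_eq_zero.1 (congrFun (key i) (Sum.inl j))
      · ext i j
        exact sub_eq_zero.1 (congrFun (key i) (Sum.inr j))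
    · intro hs
      obtain ⟨rfl, rfl⟩ := Prod.ext_iff.1 hs
      rfl
end

section
/- If the column span of [X;U] is all of ℝ^{n+m}, then the input sectional data (X,U) is sufficiently rich for identifying every property Σ_P. -/
open Matrix

/-- if the column span of [X;U] is all of ℝ^{n+m}, then (X,U) is
sufficiently rich for identifying every property Σ_P. -/
theorem statement8 {n m k : ℕ} (hn : 1 ≤ n) (hm : 1 ≤ m)
    (X : Matrix (Fin n) (Fin k) ℝ) (U : Matrix (Fin m) (Fin k) ℝ)
    (h : colSpan X U = ⊤) (P : Set (Sys n m)) :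
    suffRich X U P := by
  intro A B
  have key : ∀ s ∈ consistSet X U A B, s = (A, B) := by
    rintro ⟨A', B'⟩ hs
    have hs' : A' * X + B' * U = A * X + B * U := hs
    have hM : fromCols A' B' * fromRows X U = fromCols A B * fromRows X U := by
      rw [fromCols_mul_fromRows, fromCols_mul_fromRows, hs']
    have hL : (fromCols A' B').mulVecLin = (fromCols A B).mulVecLin := by
      refine LinearMap.ext_on h ?_
      rintro _ ⟨j, rfl⟩
      funext i
      exact congrFun (congrFun hM i) j
    have hF : fromCols A' B' = fromCols A B := Matrix.toLin'.injective hL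
    obtain ⟨h1, h2⟩ := fromCols_inj hF
    rw [h1, h2]
  by_cases hP : (A, B) ∈ P
  · left
    intro s hs
    rw [key s hs]
    exact hP
  · right
    intro s hs
    rw [key s hs]
    exact hP
end

section
/- Let n = 1 and let Σ_P be the set of controllable linear systems. An input sectional data (X,U) is sufficiently rich for identifying Σ_P if and only if the column span of [X;U] contains the subspace {v ∈ ℝ^{1+m} : v₁ = 0} = span(e₂, e₃, ..., e_{m+1}), where e_i denotes the i-th standard unit vector of ℝ^{1+m}. -/
open Matrix

/-- (A,B) is controllable: the controllability matrix [B, AB, ..., A^{n-1}B] has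
rank n. -/
def Controllable {n m : ℕ} (A : Matrix (Fin n) (Fin n) ℝ) (B : Matrix (Fin n) (Fin m) ℝ) :
    Prop :=
  (Matrix.of fun (i : Fin n) (pq : Fin n × Fin m) => (A ^ (pq.1 : ℕ) * B) i pq.2).rank = n

theorem rank_one_row {ι : Type} [Fintype ι] [DecidableEq ι] (M : Matrix (Fin 1) ι ℝ)
    (hM : M ≠ 0) : M.rank = 1 := by
  have h1 : M.rank ≤ 1 := by
    have := M.rank_le_card_height
    rwa [Fintype.card_fin] at this
  have h2 : M.rank ≠ 0 := by
    intro h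
    apply hM
    rw [Matrix.rank, Submodule.finrank_eq_zero, LinearMap.range_eq_bot] at h
    ext i j
    have h3 := congrFun (LinearMap.congr_fun h (Pi.single j 1)) i
    simpa using h3
  omega

theorem ctrl_iff {m : ℕ} (A : Matrix (Fin 1) (Fin 1) ℝ) (B : Matrix (Fin 1) (Fin m) ℝ) :
    Controllable A B ↔ B ≠ 0 := by
  unfold Controllable
  constructor
  · rintro h rfl
    have h0 : (Matrix.of fun (i : Fin 1) (pq : Fin 1 × Fin m) =>
        (A ^ (pq.1 : ℕ) * (0 : Matrix (Fin 1) (Fin m) ℝ)) i pq.2) = 0 := by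
      ext i pq
      simp
    rw [h0, Matrix.rank_zero] at h
    omega
  · intro hB
    apply rank_one_row
    intro h
    apply hB
    ext i j
    have h1 := congrFun (congrFun h i) ((0 : Fin 1), j)
    simpa using h1

theorem consist_iff_s10 {m k : ℕ} (X : Matrix (Fin 1) (Fin k) ℝ) (U : Matrix (Fin m) (Fin k) ℝ)
    (A A' : Matrix (Fin 1) (Fin 1) ℝ) (B B' : Matrix (Fin 1) (Fin m) ℝ) :
    (A', B') ∈ consistSet X U A B ↔
      ∀ c, A' 0 0 * X 0 c + ∑ j, B' 0 j * U j c = A 0 0 * X 0 c + ∑ j, B 0 j * U j c := by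
  simp only [consistSet, Set.mem_ofPred_eq]
  rw [← Matrix.ext_iff]
  simp [Matrix.mul_apply]

/-- for n = 1 and Σ_P the set of controllable systems, (X,U) is
sufficiently rich iff the column span of [X;U] contains the subspace
{v : v₁ = 0} = span(e₂,...,e_{m+1}). -/
theorem statement10 {m k : ℕ} (hm : 1 ≤ m)
    (X : Matrix (Fin 1) (Fin k) ℝ) (U : Matrix (Fin m) (Fin k) ℝ) :
    (LinearMap.ker (LinearMap.proj (Sum.inl 0) :
        ((Fin 1 ⊕ Fin m) → ℝ) →ₗ[ℝ] ℝ) =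
      Submodule.span ℝ (Set.range fun j : Fin m =>
        (Pi.single (Sum.inr j) 1 : Fin 1 ⊕ Fin m → ℝ))) ∧
    (suffRich X U {s : Sys 1 m | Controllable s.1 s.2} ↔
      Submodule.span ℝ (Set.range fun j : Fin m =>
        (Pi.single (Sum.inr j) 1 : Fin 1 ⊕ Fin m → ℝ)) ≤ colSpan X U) := by
  refine ⟨?_, ?_, ?_⟩
  · apply le_antisymm
    · intro v hv
      have hv0 : v (Sum.inl 0) = 0 := by simpa using hv
      have e : v = ∑ j : Fin m, v (Sum.inr j) •
          (Pi.single (Sum.inr j) 1 : Fin 1 ⊕ Fin m → ℝ) := by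
        ext x
        rcases x with x | x
        · have hx : x = 0 := Subsingleton.elim _ _
          subst hx
          simp [hv0, Finset.sum_apply, Pi.single_apply]
        · simp [Finset.sum_apply, Pi.single_apply]
      rw [e]
      exact Submodule.sum_mem _ fun j _ =>
        Submodule.smul_mem _ _ (Submodule.subset_span ⟨j, rfl⟩)
    · rw [Submodule.span_le]
      rintro _ ⟨j, rfl⟩
      simp
  · intro h
    rw [Submodule.span_le]
    rintro _ ⟨j, rfl⟩
    by_contra hj
    obtain ⟨f, hf, hker⟩ := Submodule.exists_le_ker_of_notMem hj
    let A : Matrix (Fin 1) (Fin 1) ℝ := fun _ _ => f (Pi.single (Sum.inl 0) 1)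
    let B : Matrix (Fin 1) (Fin m) ℝ := fun _ j => f (Pi.single (Sum.inr j) 1)
    have hz : ((0, 0) : Sys 1 m) ∈ consistSet X U 0 0 := by
      rw [consist_iff_s10]
      simp
    have hAB : ((A, B) : Sys 1 m) ∈ consistSet X U 0 0 := by
      rw [consist_iff_s10]
      intro c
      have hc : f ((Matrix.fromRows X U)ᵀ c) = 0 :=
        hker (Submodule.subset_span ⟨c, rfl⟩)
      rw [LinearMap.pi_apply_eq_sum_univ f] at hc
      have e : ∀ i : Fin 1 ⊕ Fin m, (fun j => if i = j then (1 : ℝ) else 0) = Pi.single i 1 := by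
        intro i
        ext x
        simp [Pi.single_apply, eq_comm]
      simp only [e, Fintype.sum_sum_type] at hc
      simpa [A, B, mul_comm] using hc
    rcases h 0 0 with h | h
    · exact (ctrl_iff _ _).1 (h hz) rfl
    · apply h hAB
      refine (ctrl_iff _ _).2 fun hB => hf ?_
      exact congrFun (congrFun hB 0) j
  · intro h A B
    have key : ∀ s ∈ consistSet X U A B, s.2 = B := by
      rintro ⟨A', B'⟩ hs
      rw [consist_iff_s10] at hs
      let f : (Fin 1 ⊕ Fin m → ℝ) →ₗ[ℝ] ℝ :=
        Fintype.linearCombination ℝ (Sum.elim (fun _ => A' 0 0 - A 0 0) (fun j => B' 0 j - B 0 j))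
      have hf : colSpan X U ≤ LinearMap.ker f := by
        unfold colSpan
        rw [Submodule.span_le]
        rintro _ ⟨c, rfl⟩
        have := hs c
        simp only [SetLike.mem_coe, LinearMap.mem_ker, f, Fintype.linearCombination_apply,
          Fintype.sum_sum_type]
        simp [mul_sub, Finset.sum_sub_distrib, mul_comm] at this ⊢
        linarith
      ext i j
      have hi : i = 0 := Subsingleton.elim _ _
      subst hi
      have hj := hf (h (Submodule.subset_span ⟨j, rfl⟩))
      have hj' : B' 0 j - B 0 j = 0 := by
        simpa [f, Fintype.linearCombination_apply, Pi.single_apply] using hj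
      exact sub_eq_zero.1 hj'
    by_cases hB : B = 0
    · right
      intro s hs hc
      exact (ctrl_iff _ _).1 hc ((key s hs).trans hB)
    · left
      intro s hs
      refine (ctrl_iff _ _).2 ?_
      rw [key s hs]
      exact hB
end

section
/- Let n ≥ 2 and let Σ_P be the set of controllable linear systems. An input sectional data (X,U) is sufficiently rich for identifying Σ_P if and only if the column span of [X;U] is all of ℝ^{n+m}. -/
open Matrix

lemma exists_shift {n : ℕ} (hn : 2 ≤ n) (b : Fin n → ℝ) (hb : b ≠ 0) :
    ∃ (A : Matrix (Fin n) (Fin n) ℝ) (v : Module.Basis (Fin n) ℝ (Fin n → ℝ)),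
      ∀ i : Fin n, (A ^ (i : ℕ)) *ᵥ b = v i := by
  have h0 : 0 < n := by omega
  have hs : (Pi.single (⟨0, h0⟩ : Fin n) (1 : ℝ) : Fin n → ℝ) ≠ 0 := by
    simp
  obtain ⟨T, hT⟩ := SeparatingDual.exists_continuousLinearEquiv_apply_eq (R := ℝ) hs hb
  let v := (Pi.basisFun ℝ (Fin n)).map T.toLinearEquiv
  have hv0 : v ⟨0, h0⟩ = b := by simp [v, hT]
  let L := v.constr ℝ (fun i : Fin n => if h : (i : ℕ) + 1 < n then v ⟨i + 1, h⟩ else 0)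
  refine ⟨LinearMap.toMatrix' L, v, ?_⟩
  rintro ⟨i, hi⟩
  induction i with
  | zero => simp [hv0]
  | succ k ih =>
    have := ih (by omega)
    simp only at this ⊢
    rw [pow_succ', ← Matrix.mulVec_mulVec, this, LinearMap.toMatrix'_mulVec]
    simp only [L, Module.Basis.constr_basis]
    simp [hi]

lemma ctrb_of_basis {n m : ℕ} (A : Matrix (Fin n) (Fin n) ℝ) (b : Fin n → ℝ) (η : Fin m → ℝ)
    (hη : η ≠ 0) (v : Module.Basis (Fin n) ℝ (Fin n → ℝ))
    (h : ∀ i : Fin n, (A ^ (i : ℕ)) *ᵥ b = v i) : Controllable A (vecMulVec b η) := by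
  obtain ⟨j, hj⟩ := Function.ne_iff.mp hη
  simp only [Pi.zero_apply] at hj
  unfold Controllable
  rw [Matrix.rank_eq_finrank_span_cols]
  have : Submodule.span ℝ (Set.range (Matrix.of fun (i : Fin n) (pq : Fin n × Fin m) =>
      (A ^ (pq.1 : ℕ) * vecMulVec b η) i pq.2).col) = ⊤ := by
    rw [eq_top_iff, ← v.span_eq, Submodule.span_le]
    rintro _ ⟨i, rfl⟩
    have e : v i = (η j)⁻¹ • (Matrix.of fun (i : Fin n) (pq : Fin n × Fin m) =>
      (A ^ (pq.1 : ℕ) * vecMulVec b η) i pq.2).col (i, j) := by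
      ext r
      simp only [Pi.smul_apply, Matrix.col_apply, Matrix.of_apply, smul_eq_mul,
        Matrix.mul_vecMulVec, vecMulVec_apply, h]
      field_simp
    rw [e]
    exact Submodule.smul_mem _ _ (Submodule.subset_span ⟨_, rfl⟩)
  rw [this]
  simp

lemma not_ctrb {n m : ℕ} (hn : 2 ≤ n) (A : Matrix (Fin n) (Fin n) ℝ) (b : Fin n → ℝ)
    (η : Fin m → ℝ) (h : A *ᵥ b = 0) : ¬ Controllable A (vecMulVec b η) := by
  unfold Controllable
  rw [Matrix.rank_eq_finrank_span_cols]
  have : Submodule.span ℝ (Set.range (Matrix.of fun (i : Fin n) (pq : Fin n × Fin m) =>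
      (A ^ (pq.1 : ℕ) * vecMulVec b η) i pq.2).col) ≤ Submodule.span ℝ {b} := by
    rw [Submodule.span_le]
    rintro _ ⟨⟨i, j⟩, rfl⟩
    have e : (Matrix.of fun (i : Fin n) (pq : Fin n × Fin m) =>
      (A ^ (pq.1 : ℕ) * vecMulVec b η) i pq.2).col (i, j) = η j • ((A ^ (i : ℕ)) *ᵥ b) := by
      ext r
      simp only [Pi.smul_apply, Matrix.col_apply, Matrix.of_apply, smul_eq_mul,
        Matrix.mul_vecMulVec, vecMulVec_apply]
      ring
    rw [e]
    apply Submodule.smul_mem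
    rcases Nat.eq_zero_or_pos (i : ℕ) with h0 | h0
    · rw [h0]; simp
    · obtain ⟨k, hk⟩ := Nat.exists_eq_succ_of_ne_zero h0.ne'
      rw [hk, Nat.succ_eq_add_one, pow_succ, ← Matrix.mulVec_mulVec, h]
      simp
  have h1 := Submodule.finrank_mono this
  have h2 := finrank_span_le_card (R := ℝ) ({b} : Set (Fin n → ℝ))
  simp only [Set.toFinset_singleton, Finset.card_singleton] at h2
  omega

/-- for n ≥ 2 and Σ_P the set of controllable systems, (X,U) is
sufficiently rich iff the column span of [X;U] is all of ℝ^{n+m}. -/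
theorem statement11 {n m k : ℕ} (hn : 2 ≤ n) (hm : 1 ≤ m)
    (X : Matrix (Fin n) (Fin k) ℝ) (U : Matrix (Fin m) (Fin k) ℝ) :
    suffRich X U {s : Sys n m | Controllable s.1 s.2} ↔ colSpan X U = ⊤ := by
  constructor
  · intro hr
    by_contra hne
    obtain ⟨f, hf0, hf⟩ := Submodule.exists_le_ker_of_lt_top _ (lt_top_iff_ne_top.mpr hne)
    let ξ : Fin n → ℝ := fun i => f (Pi.single (Sum.inl i) 1)
    let η : Fin m → ℝ := fun i => f (Pi.single (Sum.inr i) 1)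
    have hfx : ∀ x, f x = ∑ i, x (Sum.inl i) * ξ i + ∑ i, x (Sum.inr i) * η i := by
      intro x
      have := LinearMap.pi_apply_eq_sum_univ f x
      have e : ∀ s : Fin n ⊕ Fin m, (fun j => if s = j then (1 : ℝ) else 0) = Pi.single s 1 := by
        intro s
        ext a
        simp [Pi.single_apply, eq_comm]
      simp only [e] at this
      rw [this, Fintype.sum_sum_type]
      simp only [smul_eq_mul, ξ, η]
    have hz : ∀ c, ∑ i, X i c * ξ i + ∑ i, U i c * η i = 0 := by
      intro c
      have : (fromRows X U)ᵀ c ∈ LinearMap.ker f := hf (Submodule.subset_span ⟨c, rfl⟩)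
      rw [LinearMap.mem_ker, hfx] at this
      simpa using this
    have hcons : ∀ A B (v : Fin n → ℝ),
        ((A + vecMulVec v ξ, B + vecMulVec v η) : Sys n m) ∈ consistSet X U A B := by
      intro A B v
      have : vecMulVec v ξ * X + vecMulVec v η * U = 0 := by
        ext r c
        have := hz c
        simp only [Matrix.add_apply, Matrix.mul_apply, vecMulVec_apply, Matrix.zero_apply]
        calc _ = v r * (∑ i, X i c * ξ i + ∑ i, U i c * η i) := by
              rw [mul_add, Finset.mul_sum, Finset.mul_sum]
              congr 1 <;> exact Finset.sum_congr rfl fun _ _ => by ring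
          _ = 0 := by rw [this, mul_zero]
      show (A + vecMulVec v ξ) * X + (B + vecMulVec v η) * U = A * X + B * U
      rw [Matrix.add_mul, Matrix.add_mul, add_add_add_comm, this, add_zero]
    have key : ∀ A B (v : Fin n → ℝ), Controllable A B →
        ¬ Controllable (A + vecMulVec v ξ) (B + vecMulVec v η) → False := by
      intro A B v h1 h2
      rcases hr A B with h | h
      · have h4 := h (hcons A B v)
        rw [Set.mem_ofPred_eq] at h4
        exact h2 h4
      · have h3 : ((A, B) : Sys n m) ∈ consistSet X U A B := by
          unfold consistSet
          rw [Set.mem_ofPred_eq]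
        have h4 := h h3
        rw [Set.mem_compl_iff, Set.mem_ofPred_eq] at h4
        exact h4 h1
    by_cases hη : η = 0
    · have hξ : ξ ≠ 0 := by
        intro hξ
        apply hf0
        ext x
        simp [hfx, hξ, hη]
      obtain ⟨A, v, hv⟩ := exists_shift hn ξ hξ
      have hd : ξ ⬝ᵥ ξ ≠ 0 := fun h => hξ (dotProduct_self_eq_zero.mp h)
      have h1 : (fun _ => 1 : Fin m → ℝ) ≠ 0 := by
        intro h
        have := congrFun h ⟨0, hm⟩
        simp at this
      refine key A (vecMulVec ξ fun _ => 1) (-(ξ ⬝ᵥ ξ)⁻¹ • (A *ᵥ ξ))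
        (ctrb_of_basis A ξ _ h1 v hv) ?_
      have : vecMulVec (-(ξ ⬝ᵥ ξ)⁻¹ • (A *ᵥ ξ)) η = 0 := by
        rw [hη]; ext r c; simp [vecMulVec_apply]
      rw [this, add_zero]
      apply not_ctrb hn
      rw [Matrix.add_mulVec, Matrix.vecMulVec_mulVec]
      ext r
      simp
      field_simp
      ring
    · let b : Fin n → ℝ := fun _ => 1
      have hb : b ≠ 0 := by
        intro h
        have := congrFun h ⟨0, by omega⟩
        simp [b] at this
      obtain ⟨A, v, hv⟩ := exists_shift hn b hb
      refine key A (vecMulVec b η) (-b) (ctrb_of_basis A b η hη v hv) ?_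
      have : vecMulVec b η + vecMulVec (-b) η = vecMulVec (0 : Fin n → ℝ) η := by
        rw [← Matrix.add_vecMulVec]; simp
      rw [this]
      exact not_ctrb hn _ _ _ (by simp)
  · intro ht A B
    have huniq : ∀ s ∈ consistSet X U A B, s = (A, B) := by
      rintro ⟨A', B'⟩ hs
      have hs : A' * X + B' * U = A * X + B * U := hs
      have hmul : fromCols A' B' * fromRows X U = fromCols A B * fromRows X U := by
        simpa [Matrix.fromCols_mul_fromRows] using hs
      have hlin : Matrix.mulVecLin (fromCols A' B') = Matrix.mulVecLin (fromCols A B) := by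
        apply LinearMap.ext_on ht
        rintro _ ⟨c, rfl⟩
        ext r
        exact congrFun (congrFun hmul r) c
      have he : fromCols A' B' = fromCols A B := by
        apply Matrix.toLin'.injective
        rw [Matrix.toLin'_apply', Matrix.toLin'_apply', hlin]
      obtain ⟨h1, h2⟩ := Matrix.fromCols_inj he
      rw [h1, h2]
    by_cases hc : Controllable A B
    · left; intro s hs; rw [huniq s hs]; exact hc
    · right; intro s hs; rw [huniq s hs]; exact hc
end

section
/- Let I_A ⊆ {1,...,n}×{1,...,n} and I_B ⊆ {1,...,n}×{1,...,m} be index sets with I_A ∪ I_B nonempty, and let Σ_P = {(A,B) : A_{ji} = 0 for all (j,i) ∈ I_A and B_{pq} = 0 for all (p,q) ∈ I_B}. Let I_P = {i ∈ {1,...,n+m} : there exists j with (j,i) ∈ I_A, or i > n and there exists p with (p, i−n) ∈ I_B}. Then an input sectional data (X,U) is sufficiently rich for identifying Σ_P if and only if the column span of [X;U] contains span{e_i : i ∈ I_P}, where e_i is the i-th standard unit vector of ℝ^{n+m}. -/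
open Matrix

lemma key_aux {n m k : ℕ} (X : Matrix (Fin n) (Fin k) ℝ) (U : Matrix (Fin m) (Fin k) ℝ)
    (i : Fin n ⊕ Fin m) :
    (Pi.single i 1 : Fin n ⊕ Fin m → ℝ) ∈ colSpan X U ↔
      ∀ (a : Fin n → ℝ) (b : Fin m → ℝ),
        (∀ c, ∑ j, a j * X j c + ∑ j, b j * U j c = 0) → Sum.elim a b i = 0 := by
  constructor
  · intro h a b hab
    have hle : colSpan X U ≤ LinearMap.ker (dotProductBilin ℝ ℝ (Sum.elim a b)) := by
      unfold colSpan
      rw [Submodule.span_le]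
      rintro _ ⟨c, rfl⟩
      simpa [dotProduct, Fintype.sum_sum_type] using hab c
    have := hle h
    simpa using this
  · intro h
    by_contra hn
    obtain ⟨f, hf, hle⟩ := Submodule.exists_le_ker_of_notMem hn
    have hrep : ∀ v, f v = ∑ j, f (Pi.single j 1) * v j := by
      intro v
      conv_lhs => rw [pi_eq_sum_univ' v]
      simp [map_sum, mul_comm]
    apply hf
    have h2 := h (fun j => f (Pi.single (Sum.inl j) 1)) (fun j => f (Pi.single (Sum.inr j) 1)) ?_
    · cases i <;> simpa using h2
    · intro c
      have : (fromRows X U)ᵀ c ∈ colSpan X U := Submodule.subset_span ⟨c, rfl⟩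
      have h3 : f ((fromRows X U)ᵀ c) = 0 := hle this
      rw [hrep] at h3
      simpa [Fintype.sum_sum_type] using h3

lemma rich_aux {n m k : ℕ} (X : Matrix (Fin n) (Fin k) ℝ) (U : Matrix (Fin m) (Fin k) ℝ)
    (i : Fin n ⊕ Fin m) (h : (Pi.single i 1 : Fin n ⊕ Fin m → ℝ) ∈ colSpan X U)
    (A A' : Matrix (Fin n) (Fin n) ℝ) (B B' : Matrix (Fin n) (Fin m) ℝ)
    (e : A * X + B * U = A' * X + B' * U) (r : Fin n) :
    Sum.elim (A r) (B r) i = Sum.elim (A' r) (B' r) i := by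
  have h1 := (key_aux X U i).1 h (A r - A' r) (B r - B' r) (by
    intro c
    have := congrFun (congrFun e r) c
    simp only [Matrix.add_apply, Matrix.mul_apply] at this
    simp only [Pi.sub_apply, sub_mul, Finset.sum_sub_distrib]
    linarith)
  cases i <;> simpa [sub_eq_zero] using h1

lemma conv_aux {n m k : ℕ} (X : Matrix (Fin n) (Fin k) ℝ) (U : Matrix (Fin m) (Fin k) ℝ)
    (i : Fin n ⊕ Fin m) (r : Fin n)
    (h : ∀ (A : Matrix (Fin n) (Fin n) ℝ) (B : Matrix (Fin n) (Fin m) ℝ),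
      A * X + B * U = 0 → Sum.elim (A r) (B r) i = 0) :
    (Pi.single i 1 : Fin n ⊕ Fin m → ℝ) ∈ colSpan X U := by
  rw [key_aux]
  intro a b hab
  exact h (fun _ => a) (fun _ => b) (by
    ext s c
    exact hab c)


/-- for the structural (sparsity) property determined by index sets I_A
and I_B, (X,U) is sufficiently rich iff the column span of [X;U] contains
span{e_i : i ∈ I_P}, where I_P collects the columns of [A,B] containing a
zero-constrained entry. -/
theorem statement12 {n m k : ℕ} (hn : 1 ≤ n) (hm : 1 ≤ m)
    (IA : Set (Fin n × Fin n)) (IB : Set (Fin n × Fin m))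
    (hne : IA.Nonempty ∨ IB.Nonempty)
    (X : Matrix (Fin n) (Fin k) ℝ) (U : Matrix (Fin m) (Fin k) ℝ) :
    suffRich X U
        {s : Sys n m | (∀ p ∈ IA, s.1 p.1 p.2 = 0) ∧ (∀ p ∈ IB, s.2 p.1 p.2 = 0)} ↔
      Submodule.span ℝ
        ((fun i : Fin n => (Pi.single (Sum.inl i) 1 : Fin n ⊕ Fin m → ℝ)) ''
            {i | ∃ j, (j, i) ∈ IA} ∪
          (fun q : Fin m => (Pi.single (Sum.inr q) 1 : Fin n ⊕ Fin m → ℝ)) ''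
            {q | ∃ p, (p, q) ∈ IB}) ≤ colSpan X U := by
  rw [Submodule.span_le, Set.union_subset_iff]
  constructor
  · intro h
    have h0 : ∀ (A : Matrix (Fin n) (Fin n) ℝ) (B : Matrix (Fin n) (Fin m) ℝ),
        A * X + B * U = 0 →
        (∀ p ∈ IA, A p.1 p.2 = 0) ∧ (∀ p ∈ IB, B p.1 p.2 = 0) := by
      intro A B hAB
      rcases h 0 0 with h | h
      · exact h (show (A, B) ∈ consistSet X U 0 0 by simpa [consistSet] using hAB)
      · exact absurd (show ((0, 0) : Sys n m) ∈ _ by simp)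
          (h (show ((0, 0) : Sys n m) ∈ consistSet X U 0 0 by simp [consistSet]))
    constructor
    · rintro _ ⟨i, ⟨j, hj⟩, rfl⟩
      exact conv_aux X U (Sum.inl i) j fun A B e => (h0 A B e).1 _ hj
    · rintro _ ⟨i, ⟨j, hj⟩, rfl⟩
      exact conv_aux X U (Sum.inr i) j fun A B e => (h0 A B e).2 _ hj
  · rintro ⟨hA, hB⟩ A B
    have hA' : ∀ s ∈ consistSet X U A B, ∀ p ∈ IA, s.1 p.1 p.2 = A p.1 p.2 := by
      intro s hs p hp
      exact rich_aux X U (Sum.inl p.2) (hA ⟨p.2, ⟨p.1, hp⟩, rfl⟩) s.1 A s.2 B hs p.1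
    have hB' : ∀ s ∈ consistSet X U A B, ∀ p ∈ IB, s.2 p.1 p.2 = B p.1 p.2 := by
      intro s hs p hp
      exact rich_aux X U (Sum.inr p.2) (hB ⟨p.2, ⟨p.1, hp⟩, rfl⟩) s.1 A s.2 B hs p.1
    by_cases hP : (∀ p ∈ IA, A p.1 p.2 = 0) ∧ (∀ p ∈ IB, B p.1 p.2 = 0)
    · left
      intro s hs
      exact ⟨fun p hp => (hA' s hs p hp).trans (hP.1 p hp),
        fun p hp => (hB' s hs p hp).trans (hP.2 p hp)⟩
    · right
      intro s hs hsP
      exact hP ⟨fun p hp => (hA' s hs p hp).symm.trans (hsP.1 p hp),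
        fun p hp => (hB' s hs p hp).symm.trans (hsP.2 p hp)⟩
end
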